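/- Let n ≥ 5, let M be a symmetric real (n−1)×(n−1) matrix, let λ > 0 be an eigenvalue of M and u a unit eigenvector of M for λ. Set c̄ = (n−2)/2^{n−1} and x̄ = (c̄/λ)^{1/n} u. Then x̄ satisfies M x̄ = c̄ x̄/|x̄|^n, and the pair (x̄, −x̄) is a critical point of the function F defined on 𝔽₂(ℝ^{n−1}) = {(x,y) : x ≠ y} by F(x,y) = (1/2)⟨Mx,x⟩ + (1/2)⟨My,y⟩ + 1/|x−y|^{n−2}, i.e. the Fréchet derivative of F vanishes at (x̄, −x̄). -/

import Mathlib

open scoped RealInnerProductSpace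

/-- The derivative of `z ↦ 1 / ‖z‖ ^ m` away from the origin. -/
theorem hasFDerivAt_one_div_norm_pow {E : Type*} [NormedAddCommGroup E] [InnerProductSpace ℝ E]
    (m : ℕ) {z : E} (hz : z ≠ 0) :
    HasFDerivAt (fun w : E => 1 / ‖w‖ ^ m) (-(m / ‖z‖ ^ (m + 2)) • innerSL ℝ z) z := by
  have hz' : ‖z‖ ≠ 0 := norm_ne_zero_iff.mpr hz
  have hnorm : HasFDerivAt (fun w : E => ‖w‖) (‖z‖⁻¹ • innerSL ℝ z) z := by
    have h := (hasStrictFDerivAt_norm_sq z).hasFDerivAt.sqrt (pow_ne_zero 2 hz')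
    simp only [Real.sqrt_sq (norm_nonneg _)] at h
    refine h.congr_fderiv ?_
    ext v
    simp
    field_simp
  have hpow : HasDerivAt (fun t : ℝ => 1 / t ^ m) (-(m / ‖z‖ ^ (m + 1))) ‖z‖ := by
    have h := hasDerivAt_zpow (-(m : ℤ)) ‖z‖ (Or.inl hz')
    have he : ((-(m : ℤ) : ℤ) : ℝ) * ‖z‖ ^ (-(m : ℤ) - 1) = -(m / ‖z‖ ^ (m + 1)) := by
      rw [show -(m : ℤ) - 1 = -((m + 1 : ℕ) : ℤ) by push_cast; ring, zpow_neg, zpow_natCast]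
      push_cast
      ring
    rw [he] at h
    simpa [zpow_neg] using h
  refine (hpow.comp_hasFDerivAt z hnorm).congr_fderiv ?_
  ext v
  simp
  field_simp
  ring

/-- The derivative of the quadratic form of a symmetric continuous linear map. -/
theorem hasFDerivAt_half_inner_self {E : Type*} [NormedAddCommGroup E] [InnerProductSpace ℝ E]
    (A : E →L[ℝ] E) (hA : ∀ x y, ⟪A x, y⟫ = ⟪x, A y⟫) (x : E) :
    HasFDerivAt (fun w : E => (1 / 2 : ℝ) * ⟪A w, w⟫) (innerSL ℝ (A x)) x := by
  refine ((A.hasFDerivAt.inner ℝ (hasFDerivAt_id x)).const_mul (1 / 2 : ℝ)).congr_fderiv ?_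
  ext v
  simp [hA v x, real_inner_comm (A x) v]
  ring

/-- If `lam > 0` is an eigenvalue of the symmetric matrix `M` with unit
eigenvector `u`, then `x̄ = (c̄/lam)^(1/n) u` satisfies `M x̄ = c̄ x̄ / |x̄|^n` and
`(x̄, -x̄)` is a critical point of `F`. -/
theorem stmt_7 (n : ℕ) (hn : 5 ≤ n)
    (M : EuclideanSpace ℝ (Fin (n - 1)) →ₗ[ℝ] EuclideanSpace ℝ (Fin (n - 1)))
    (hsymm : ∀ x y, ⟪M x, y⟫ = ⟪x, M y⟫)
    (lam : ℝ) (hlam : 0 < lam)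
    (u : EuclideanSpace ℝ (Fin (n - 1))) (hu : ‖u‖ = 1) (heig : M u = lam • u)
    (c : ℝ) (hc : c = ((n : ℝ) - 2) / 2 ^ (n - 1))
    (xbar : EuclideanSpace ℝ (Fin (n - 1)))
    (hxbar : xbar = ((c / lam) ^ ((1 : ℝ) / n)) • u)
    (F : EuclideanSpace ℝ (Fin (n - 1)) × EuclideanSpace ℝ (Fin (n - 1)) → ℝ)
    (hF : ∀ p, F p = (1 / 2) * ⟪M p.1, p.1⟫ + (1 / 2) * ⟪M p.2, p.2⟫
      + 1 / ‖p.1 - p.2‖ ^ (n - 2)) :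
    M xbar = (c / ‖xbar‖ ^ n) • xbar ∧ fderiv ℝ F (xbar, -xbar) = 0 := by
  have hn0 : (n : ℝ) ≠ 0 := by positivity
  have hcpos : 0 < c := by
    have : (5 : ℝ) ≤ n := by exact_mod_cast hn
    rw [hc]
    exact div_pos (by linarith) (by positivity)
  have hr : 0 < (c / lam) ^ ((1 : ℝ) / n) := Real.rpow_pos_of_pos (div_pos hcpos hlam) _
  have hnorm : ‖xbar‖ = (c / lam) ^ ((1 : ℝ) / n) := by
    rw [hxbar, norm_smul, hu, mul_one, Real.norm_of_nonneg hr.le]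
  have hpow : ‖xbar‖ ^ n = c / lam := by
    rw [hnorm, ← Real.rpow_natCast, ← Real.rpow_mul (div_pos hcpos hlam).le,
      one_div_mul_cancel hn0, Real.rpow_one]
  have hM : M xbar = (c / ‖xbar‖ ^ n) • xbar := by
    rw [hpow, div_div_cancel₀ hcpos.ne', hxbar, map_smul, heig, smul_comm]
  refine ⟨hM, ?_⟩
  have hx : xbar ≠ 0 := norm_pos_iff.mp (hnorm ▸ hr)
  have hz : xbar - -xbar = (2 : ℝ) • xbar := by rw [two_smul, sub_neg_eq_add]
  have hz0 : xbar - -xbar ≠ 0 := hz ▸ smul_ne_zero two_ne_zero hx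
  have hcoef : ((n - 2 : ℕ) : ℝ) / ‖xbar - -xbar‖ ^ (n - 2 + 2) * 2 = c / ‖xbar‖ ^ n := by
    obtain ⟨k, rfl⟩ := Nat.exists_eq_add_of_le' (show 2 ≤ n by omega)
    have : ‖xbar‖ ≠ 0 := norm_ne_zero_iff.mpr hx
    rw [hc, hz, norm_smul, Real.norm_two, mul_pow]
    simp only [Nat.add_sub_cancel, show k + 2 - 1 = k + 1 by omega]
    push_cast
    field_simp
    ring
  have hq := hasFDerivAt_half_inner_self M.toContinuousLinearMap hsymm
  have hsub : HasFDerivAt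
      (fun p : EuclideanSpace ℝ (Fin (n - 1)) × EuclideanSpace ℝ (Fin (n - 1)) => p.1 - p.2)
      (.fst ℝ _ _ - .snd ℝ _ _) (xbar, -xbar) := hasFDerivAt_fst.fun_sub hasFDerivAt_snd
  have hder := (((hq xbar).comp (xbar, -xbar) hasFDerivAt_fst).add
    ((hq (-xbar)).comp (xbar, -xbar) hasFDerivAt_snd)).add
    ((hasFDerivAt_one_div_norm_pow (n - 2) hz0).comp (xbar, -xbar) hsub)
  have hFder := hder.congr_of_eventuallyEq (f₁ := F) (.of_forall hF)
  rw [hFder.fderiv]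
  ext v <;>
  · simp [hM, hz, ← hcoef]
    ring
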